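/- arXiv:2006.09486 — 2 statements merged into one kernel-verified Lean document; each statement's English description precedes it below -/
import Mathlib

section
/- Suppose (A1) the gradients of L_S and L_D are L-Lipschitz on W × Φ, (A2) L_D is M-Lipschitz, (A3) (w,φ) ↦ ∇²_w L_S(w,φ) is ρ-Lipschitz and (w,φ) ↦ ∇_φ∇_w L_S(w,φ) is τ-Lipschitz in operator norm, (SC) L_S(·,φ) is μ-strongly convex in w for every φ with 0 < μ < L, and α = μ/L². Then for every N ≥ 1 and all (w₁,φ₁), (w₂,φ₂) ∈ W × Φ: ‖G_φ(w₁,φ₁) − G_φ(w₂,φ₂)‖ ≤ (L + 2τM/μ + (2LM/μ)(αρ/(1 − αμ) + 2ρ/μ) + L²/μ)(1 − αμ)^{(N−1)/2} ‖w₁ − w₂‖ + (L + τM/μ + LMρ/μ² + L²/μ)(2L/μ + 1) ‖φ₁ − φ₂‖. -/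
noncomputable section

open scoped RealInnerProductSpace

abbrev Wsp (p : ℕ) := EuclideanSpace ℝ (Fin p)

/-- Partial gradient in the first block of variables. -/
def gradW {p q : ℕ} (f : Wsp p × Wsp q → ℝ) (w : Wsp p) (φ : Wsp q) : Wsp p :=
  gradient (fun u => f (u, φ)) w

/-- Partial gradient in the second block of variables. -/
def gradPhi {p q : ℕ} (f : Wsp p × Wsp q → ℝ) (w : Wsp p) (φ : Wsp q) : Wsp q :=
  gradient (fun ψ => f (w, ψ)) φ

/-- Inner-loop gradient descent iterates. -/
def innerIter {p q : ℕ} (f : Wsp p × Wsp q → ℝ) (α : ℝ) : ℕ → Wsp p → Wsp q → Wsp p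
  | 0, w, _ => w
  | (m+1), w, φ => innerIter f α m w φ - α • gradW f (innerIter f α m w φ) φ

/-- Hessian in `w` of `f(·,φ)` at `w`, as a continuous linear map. -/
def hessW {p q : ℕ} (f : Wsp p × Wsp q → ℝ) (w : Wsp p) (φ : Wsp q) : Wsp p →L[ℝ] Wsp p :=
  fderiv ℝ (fun u => gradW f u φ) w

/-- Mixed second derivative `∇_φ∇_w f (w,φ)`, viewed as a linear map `W → Φ`. -/
def crossD {p q : ℕ} (f : Wsp p × Wsp q → ℝ) (w : Wsp p) (φ : Wsp q) : Wsp p →L[ℝ] Wsp q :=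
  ContinuousLinearMap.adjoint (fderiv ℝ (fun ψ => gradW f w ψ) φ)

/-- Ordered product `A a * A (a+1) * ⋯ * A (b-1)` (factor `A a` leftmost, i.e. applied last). -/
def prodIco {p : ℕ} (A : ℕ → (Wsp p →L[ℝ] Wsp p)) (a b : ℕ) : Wsp p →L[ℝ] Wsp p :=
  ((List.range (b - a)).map (fun k => A (a + k))).prod

/-- `f(·,φ)` is `μc`-strongly convex in `w`, for every `φ`. -/
def StrongConvexIn {p q : ℕ} (μc : ℝ) (f : Wsp p × Wsp q → ℝ) : Prop :=
  ∀ (w w' : Wsp p) (φ : Wsp q),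
    f (w', φ) ≥ f (w, φ) + ⟪w' - w, gradW f w φ⟫ + μc / 2 * ‖w - w'‖ ^ 2

/-- The (full) gradient of `f` is `L`-Lipschitz on `W × Φ` (Euclidean norms). -/
def GradLip {p q : ℕ} (L : ℝ) (f : Wsp p × Wsp q → ℝ) : Prop :=
  ∀ (w₁ w₂ : Wsp p) (φ₁ φ₂ : Wsp q),
    Real.sqrt (‖gradW f w₁ φ₁ - gradW f w₂ φ₂‖ ^ 2 + ‖gradPhi f w₁ φ₁ - gradPhi f w₂ φ₂‖ ^ 2)
      ≤ L * Real.sqrt (‖w₁ - w₂‖ ^ 2 + ‖φ₁ - φ₂‖ ^ 2)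

/-- `f` is `M`-Lipschitz on `W × Φ` (Euclidean norms). -/
def FunLip {p q : ℕ} (M : ℝ) (f : Wsp p × Wsp q → ℝ) : Prop :=
  ∀ (w₁ w₂ : Wsp p) (φ₁ φ₂ : Wsp q),
    |f (w₁, φ₁) - f (w₂, φ₂)| ≤ M * Real.sqrt (‖w₁ - w₂‖ ^ 2 + ‖φ₁ - φ₂‖ ^ 2)

/-- `(w,φ) ↦ ∇²_w f(w,φ)` is `ρ`-Lipschitz in operator norm. -/
def HessLip {p q : ℕ} (ρ : ℝ) (f : Wsp p × Wsp q → ℝ) : Prop :=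
  ∀ (w₁ w₂ : Wsp p) (φ₁ φ₂ : Wsp q),
    ‖hessW f w₁ φ₁ - hessW f w₂ φ₂‖ ≤ ρ * Real.sqrt (‖w₁ - w₂‖ ^ 2 + ‖φ₁ - φ₂‖ ^ 2)

/-- `(w,φ) ↦ ∇_φ∇_w f(w,φ)` is `τ`-Lipschitz in operator norm. -/
def CrossLip {p q : ℕ} (τ : ℝ) (f : Wsp p × Wsp q → ℝ) : Prop :=
  ∀ (w₁ w₂ : Wsp p) (φ₁ φ₂ : Wsp q),
    ‖crossD f w₁ φ₁ - crossD f w₂ φ₂‖ ≤ τ * Real.sqrt (‖w₁ - w₂‖ ^ 2 + ‖φ₁ - φ₂‖ ^ 2)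

/-- A symmetric operator with quadratic form in `[0, c]` has norm at most `c`. -/
theorem aux_opnorm {p : ℕ} (A : Wsp p →L[ℝ] Wsp p) (c : ℝ) (hc : 0 ≤ c)
    (hsym : ∀ x y, ⟪A x, y⟫ = ⟪x, A y⟫)
    (h0 : ∀ x, 0 ≤ ⟪A x, x⟫) (h1 : ∀ x, ⟪A x, x⟫ ≤ c * ‖x‖ ^ 2) : ‖A‖ ≤ c := by
  rw [A.norm_eq_iSup_rayleighQuotient (fun x y => hsym x y)]
  refine ciSup_le fun x => ?_
  by_cases hx : x = 0
  · simp [hx, ContinuousLinearMap.rayleighQuotient, hc]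
  have hp : 0 < ‖x‖ ^ 2 := by positivity
  have e : A.rayleighQuotient x = ⟪A x, x⟫ / ‖x‖ ^ 2 := rfl
  rw [e, abs_of_nonneg (div_nonneg (h0 x) hp.le), div_le_iff₀ hp]
  exact h1 x

theorem aux_sqrt_l (a : ℝ) (ha : 0 ≤ a) : Real.sqrt (a ^ 2 + 0 ^ 2) = a := by
  simp [Real.sqrt_sq ha]

theorem aux_sqrt_r (a : ℝ) (ha : 0 ≤ a) : Real.sqrt (0 ^ 2 + a ^ 2) = a := by
  simp [Real.sqrt_sq ha]

theorem aux_sqrt_add (a b : ℝ) (ha : 0 ≤ a) (hb : 0 ≤ b) :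
    Real.sqrt (a ^ 2 + b ^ 2) ≤ a + b := by
  apply Real.sqrt_le_iff.mpr
  constructor
  · positivity
  · nlinarith [mul_nonneg ha hb]

theorem gradLip_w {p q : ℕ} {L : ℝ} {f : Wsp p × Wsp q → ℝ} (h : GradLip L f)
    (w₁ w₂ : Wsp p) (φ₁ φ₂ : Wsp q) :
    ‖gradW f w₁ φ₁ - gradW f w₂ φ₂‖ ≤ L * Real.sqrt (‖w₁ - w₂‖ ^ 2 + ‖φ₁ - φ₂‖ ^ 2) := by
  refine le_trans ?_ (h w₁ w₂ φ₁ φ₂)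
  apply Real.le_sqrt_of_sq_le
  nlinarith [sq_nonneg ‖gradPhi f w₁ φ₁ - gradPhi f w₂ φ₂‖]

theorem gradLip_phi {p q : ℕ} {L : ℝ} {f : Wsp p × Wsp q → ℝ} (h : GradLip L f)
    (w₁ w₂ : Wsp p) (φ₁ φ₂ : Wsp q) :
    ‖gradPhi f w₁ φ₁ - gradPhi f w₂ φ₂‖ ≤ L * Real.sqrt (‖w₁ - w₂‖ ^ 2 + ‖φ₁ - φ₂‖ ^ 2) := by
  refine le_trans ?_ (h w₁ w₂ φ₁ φ₂)
  apply Real.le_sqrt_of_sq_le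
  nlinarith [sq_nonneg ‖gradW f w₁ φ₁ - gradW f w₂ φ₂‖]

theorem gradLip_w1 {p q : ℕ} {L : ℝ} {f : Wsp p × Wsp q → ℝ} (h : GradLip L f)
    (w₁ w₂ : Wsp p) (φ : Wsp q) :
    ‖gradW f w₁ φ - gradW f w₂ φ‖ ≤ L * ‖w₁ - w₂‖ := by
  have := gradLip_w h w₁ w₂ φ φ
  rwa [sub_self, norm_zero, aux_sqrt_l _ (norm_nonneg _)] at this

theorem gradLip_w2 {p q : ℕ} {L : ℝ} {f : Wsp p × Wsp q → ℝ} (h : GradLip L f)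
    (w : Wsp p) (φ₁ φ₂ : Wsp q) :
    ‖gradW f w φ₁ - gradW f w φ₂‖ ≤ L * ‖φ₁ - φ₂‖ := by
  have := gradLip_w h w w φ₁ φ₂
  rwa [sub_self, norm_zero, aux_sqrt_r _ (norm_nonneg _)] at this

/-- The partial gradient as a jointly `C¹` map. -/
theorem gradW_contDiff {p q : ℕ} {f : Wsp p × Wsp q → ℝ} (hf : ContDiff ℝ 2 f) :
    ContDiff ℝ 1 (fun z : Wsp p × Wsp q => gradW f z.1 z.2) := by
  have e : (fun z : Wsp p × Wsp q => gradW f z.1 z.2) = fun z =>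
      (InnerProductSpace.toDual ℝ (Wsp p)).symm
        ((fderiv ℝ f z).comp (ContinuousLinearMap.inl ℝ (Wsp p) (Wsp q))) := by
    funext z
    unfold gradW gradient
    congr 1
    have h1 : HasFDerivAt f (fderiv ℝ f z) ((fun u => (u, z.2)) z.1) :=
      (hf.differentiable (by norm_num) z).hasFDerivAt
    exact (h1.comp z.1 (hasFDerivAt_prodMk_left z.1 z.2)).fderiv
  rw [e]
  have h2 : ContDiff ℝ 1 (fderiv ℝ f) := hf.fderiv_right (by norm_num)
  exact (InnerProductSpace.toDual ℝ (Wsp p)).symm.toContinuousLinearEquiv.contDiff.comp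
    (h2.clm_comp contDiff_const)

theorem gradW_hasFDerivAt {p q : ℕ} {f : Wsp p × Wsp q → ℝ} (hf : ContDiff ℝ 2 f)
    (w : Wsp p) (φ : Wsp q) :
    HasFDerivAt (fun u => gradW f u φ) (hessW f w φ) w := by
  have h := (gradW_contDiff hf).differentiable (by norm_num) (w, φ)
  have : DifferentiableAt ℝ (fun u => gradW f u φ) w :=
    h.comp (f := fun u => (u, φ)) w (hasFDerivAt_prodMk_left w φ).differentiableAt
  exact this.hasFDerivAt

theorem gradW_comp_hasFDerivAt {p q : ℕ} {f : Wsp p × Wsp q → ℝ} (hf : ContDiff ℝ 2 f)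
    (v : Wsp q → Wsp p) (J : Wsp q →L[ℝ] Wsp p) (φ : Wsp q) (hv : HasFDerivAt v J φ) :
    HasFDerivAt (fun ψ => gradW f (v ψ) ψ)
      ((hessW f (v φ) φ).comp J + ContinuousLinearMap.adjoint (crossD f (v φ) φ)) φ := by
  have h := ((gradW_contDiff hf).differentiable (by norm_num) (v φ, φ)).hasFDerivAt
  set D := fderiv ℝ (fun z : Wsp p × Wsp q => gradW f z.1 z.2) (v φ, φ) with hD
  have h1 : hessW f (v φ) φ = D.comp (ContinuousLinearMap.inl ℝ (Wsp p) (Wsp q)) :=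
    (h.comp (f := fun u => (u, φ)) (v φ) (hasFDerivAt_prodMk_left (v φ) φ)).fderiv
  have h2 : ContinuousLinearMap.adjoint (crossD f (v φ) φ)
      = D.comp (ContinuousLinearMap.inr ℝ (Wsp p) (Wsp q)) := by
    unfold crossD
    rw [ContinuousLinearMap.adjoint_adjoint]
    exact (h.comp (f := fun ψ => (v φ, ψ)) φ (hasFDerivAt_prodMk_right (v φ) φ)).fderiv
  have h3 := h.comp (f := fun ψ => (v ψ, ψ)) φ (hv.prodMk (hasFDerivAt_id φ))
  refine h3.congr_fderiv ?_
  rw [h1, h2]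
  ext1 x
  simp only [ContinuousLinearMap.comp_apply, add_apply,
    ContinuousLinearMap.prod_apply, ContinuousLinearMap.inl_apply, ContinuousLinearMap.inr_apply]
  rw [← map_add]
  simp

/-- Jacobian of the inner iterates with respect to `φ`. -/
def jacPhi {p q : ℕ} (f : Wsp p × Wsp q → ℝ) (α : ℝ) :
    ℕ → Wsp p → Wsp q → (Wsp q →L[ℝ] Wsp p)
  | 0, _, _ => 0
  | (m+1), w, φ =>
      (1 - α • hessW f (innerIter f α m w φ) φ).comp (jacPhi f α m w φ)
        - α • ContinuousLinearMap.adjoint (crossD f (innerIter f α m w φ) φ)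

theorem innerIter_hasFDerivAt {p q : ℕ} {f : Wsp p × Wsp q → ℝ} (hf : ContDiff ℝ 2 f)
    (α : ℝ) (w : Wsp p) (φ : Wsp q) (m : ℕ) :
    HasFDerivAt (fun ψ => innerIter f α m w ψ) (jacPhi f α m w φ) φ := by
  induction m with
  | zero => exact hasFDerivAt_const w φ
  | succ m ih =>
    have h := gradW_comp_hasFDerivAt hf _ _ φ ih
    have h2 := ih.sub (h.const_smul α)
    refine h2.congr_fderiv ?_
    ext1 x
    simp [jacPhi, smul_add, sub_sub]

theorem hessW_symm {p q : ℕ} {f : Wsp p × Wsp q → ℝ} (hf : ContDiff ℝ 2 f)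
    (w : Wsp p) (φ : Wsp q) (x y : Wsp p) :
    ⟪hessW f w φ x, y⟫ = ⟪x, hessW f w φ y⟫ := by
  have hg : ContDiff ℝ 2 (fun u => f (u, φ)) := hf.comp (contDiff_prodMk_left φ)
  have hs : IsSymmSndFDerivAt ℝ (fun u => f (u, φ)) w :=
    hg.contDiffAt.isSymmSndFDerivAt (by simp)
  have hd : HasFDerivAt (fderiv ℝ (fun u => f (u, φ)))
      (fderiv ℝ (fderiv ℝ (fun u => f (u, φ))) w) w :=
    (((hg.fderiv_right (m := 1) (by norm_num)).differentiable (by norm_num)) w).hasFDerivAt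
  have key : ∀ x y, ⟪hessW f w φ x, y⟫ = fderiv ℝ (fderiv ℝ (fun u => f (u, φ))) w x y := by
    intro x y
    have e1 := (gradW_hasFDerivAt hf w φ).inner ℝ (hasFDerivAt_const y w)
    have e2 := hd.clm_apply (hasFDerivAt_const y w)
    have e3 : (fun u => ⟪gradW f u φ, y⟫) = fun u => fderiv ℝ (fun u => f (u, φ)) u y := by
      funext u
      simp [gradW, gradient]
    rw [e3] at e1
    have := congrArg (fun T => T x) (e1.unique e2)
    simpa using this
  rw [key, real_inner_comm, key]
  exact hs x y

theorem hessW_norm_le {p q : ℕ} {L : ℝ} {f : Wsp p × Wsp q → ℝ} (hL : 0 ≤ L)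
    (h : GradLip L f) (w : Wsp p) (φ : Wsp q) : ‖hessW f w φ‖ ≤ L :=
  norm_fderiv_le_of_lip' ℝ hL (Filter.Eventually.of_forall fun u => gradLip_w1 h u w φ)

theorem crossD_norm_le {p q : ℕ} {L : ℝ} {f : Wsp p × Wsp q → ℝ} (hL : 0 ≤ L)
    (h : GradLip L f) (w : Wsp p) (φ : Wsp q) : ‖crossD f w φ‖ ≤ L := by
  unfold crossD
  rw [LinearIsometryEquiv.norm_map]
  exact norm_fderiv_le_of_lip' ℝ hL (Filter.Eventually.of_forall fun u => gradLip_w2 h w u φ)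

theorem gradW_mono {p q : ℕ} {μc : ℝ} {f : Wsp p × Wsp q → ℝ} (h : StrongConvexIn μc f)
    (w w' : Wsp p) (φ : Wsp q) :
    μc * ‖w' - w‖ ^ 2 ≤ ⟪gradW f w' φ - gradW f w φ, w' - w⟫ := by
  have h1 := h w w' φ
  have h2 := h w' w φ
  rw [norm_sub_rev] at h1
  rw [inner_sub_left, real_inner_comm, real_inner_comm (w' - w) (gradW f w φ)]
  have : ⟪w - w', gradW f w' φ⟫ = - ⟪w' - w, gradW f w' φ⟫ := by
    rw [← inner_neg_left, neg_sub]
  rw [this] at h2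
  linarith

theorem hessW_lower {p q : ℕ} {μc : ℝ} {f : Wsp p × Wsp q → ℝ} (hf : ContDiff ℝ 2 f)
    (h : StrongConvexIn μc f) (w : Wsp p) (φ : Wsp q) (x : Wsp p) :
    μc * ‖x‖ ^ 2 ≤ ⟪hessW f w φ x, x⟫ := by
  have hl : HasDerivAt (fun t : ℝ => w + t • x) x 0 := by
    simpa using ((hasDerivAt_id (0:ℝ)).smul_const x).const_add w
  have h0 : HasFDerivAt (fun u => gradW f u φ) (hessW f w φ) (w + (0:ℝ) • x) := by
    simpa using gradW_hasFDerivAt hf w φ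
  have h1 := h0.comp_hasDerivAt (0:ℝ) hl
  have h2 := h1.inner ℝ (hasDerivAt_const (0:ℝ) x)
  simp only [inner_zero_right, zero_add] at h2
  have h3 := h2.tendsto_slope_zero_right
  refine ge_of_tendsto h3 ?_
  filter_upwards [self_mem_nhdsWithin] with t ht
  have ht : 0 < t := ht
  have := gradW_mono h w (w + t • x) φ
  rw [add_sub_cancel_left, norm_smul, Real.norm_eq_abs, abs_of_pos ht, inner_smul_right,
    inner_sub_left] at this
  simp only [Function.comp, zero_add, zero_smul, add_zero, smul_eq_mul]
  rw [inv_mul_eq_div, le_div_iff₀ ht]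
  have h5 : t * (μc * ‖x‖ ^ 2 * t) ≤ t * (⟪gradW f (w + t • x) φ, x⟫ - ⟪gradW f w φ, x⟫) := by
    linarith
  exact le_of_mul_le_mul_left h5 ht

theorem step_norm_le {p q : ℕ} {L μc α : ℝ} {f : Wsp p × Wsp q → ℝ} (hf : ContDiff ℝ 2 f)
    (hL : 0 ≤ L) (h : GradLip L f) (hsc : StrongConvexIn μc f) (hα : 0 ≤ α) (hαL : α * L ≤ 1)
    (hc : 0 ≤ 1 - α * μc) (w : Wsp p) (φ : Wsp q) :
    ‖1 - α • hessW f w φ‖ ≤ 1 - α * μc := by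
  have e : ∀ x, ⟪(1 - α • hessW f w φ) x, x⟫ = ‖x‖ ^ 2 - α * ⟪hessW f w φ x, x⟫ := by
    intro x
    simp [inner_sub_left, inner_smul_left]
  apply aux_opnorm _ _ hc
  · intro x y
    simp [inner_sub_left, inner_sub_right, inner_smul_left, inner_smul_right, hessW_symm hf]
  · intro x
    rw [e]
    have h1 : ⟪hessW f w φ x, x⟫ ≤ L * ‖x‖ ^ 2 := by
      refine (real_inner_le_norm _ _).trans ?_
      have := (hessW f w φ).le_of_opNorm_le (hessW_norm_le hL h w φ) x
      nlinarith [norm_nonneg x]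
    nlinarith [mul_le_mul_of_nonneg_left h1 hα, sq_nonneg ‖x‖]
  · intro x
    rw [e]
    nlinarith [mul_le_mul_of_nonneg_left (hessW_lower hf hsc w φ x) hα]

theorem step_contract {p q : ℕ} {α c : ℝ} {f : Wsp p × Wsp q → ℝ} (hf : ContDiff ℝ 2 f)
    (φ : Wsp q) (hc : ∀ w, ‖1 - α • hessW f w φ‖ ≤ c) (x y : Wsp p) :
    ‖(x - α • gradW f x φ) - (y - α • gradW f y φ)‖ ≤ c * ‖x - y‖ := by
  refine Convex.norm_image_sub_le_of_norm_hasFDerivWithin_le (𝕜 := ℝ)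
    (f := fun u => u - α • gradW f u φ) (f' := fun w => 1 - α • hessW f w φ)
    (s := Set.univ) (fun w _ => ?_) (fun w _ => hc w) convex_univ trivial trivial
  exact ((hasFDerivAt_id w).sub ((gradW_hasFDerivAt hf w φ).const_smul α)).hasFDerivWithinAt

theorem gradient_comp {p q : ℕ} {f : Wsp p × Wsp q → ℝ} (hf : Differentiable ℝ f)
    (v : Wsp q → Wsp p) (J : Wsp q →L[ℝ] Wsp p) (φ : Wsp q) (hv : HasFDerivAt v J φ) :
    gradient (fun ψ => f (v ψ, ψ)) φ
      = gradPhi f (v φ) φ + ContinuousLinearMap.adjoint J (gradW f (v φ) φ) := by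
  have h := (hf (v φ, φ)).hasFDerivAt
  have h1 := (h.comp (f := fun u => (u, φ)) (v φ) (hasFDerivAt_prodMk_left (v φ) φ)).fderiv
  have h2 := (h.comp (f := fun ψ => (v φ, ψ)) φ (hasFDerivAt_prodMk_right (v φ) φ)).fderiv
  have h3 := (h.comp (f := fun ψ => (v ψ, ψ)) φ (hv.prodMk (hasFDerivAt_id φ))).fderiv
  refine ext_inner_right ℝ fun x => ?_
  rw [inner_add_left, ContinuousLinearMap.adjoint_inner_left]
  simp only [gradW, gradPhi, gradient, InnerProductSpace.toDual_symm_apply]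
  simp only [Function.comp_def] at h1 h2 h3
  rw [h1, h2, h3]
  simp only [ContinuousLinearMap.comp_apply,
    ContinuousLinearMap.prod_apply, ContinuousLinearMap.inl_apply, ContinuousLinearMap.inr_apply]
  rw [← map_add]
  simp

theorem gradW_norm_le {p q : ℕ} {M : ℝ} {f : Wsp p × Wsp q → ℝ} (hM : 0 ≤ M)
    (h : FunLip M f) (w : Wsp p) (φ : Wsp q) : ‖gradW f w φ‖ ≤ M := by
  unfold gradW gradient
  rw [LinearIsometryEquiv.norm_map]
  refine norm_fderiv_le_of_lip' ℝ hM (Filter.Eventually.of_forall fun u => ?_)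
  have := h u w φ φ
  rwa [sub_self, norm_zero, aux_sqrt_l _ (norm_nonneg _)] at this

theorem jac_norm_le {p q : ℕ} {L μc α : ℝ} {f : Wsp p × Wsp q → ℝ}
    (hL : 0 ≤ L) (h : GradLip L f) (hμ : 0 < μc) (hα : 0 ≤ α)
    (hstep : ∀ w φ, ‖1 - α • hessW f w φ‖ ≤ 1 - α * μc) (w : Wsp p) (φ : Wsp q) (m : ℕ) :
    ‖jacPhi f α m w φ‖ ≤ L / μc := by
  induction m with
  | zero => simp only [jacPhi, norm_zero]; positivity
  | succ m ih =>
    have h0 : 0 ≤ 1 - α * μc := (norm_nonneg _).trans (hstep w φ)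
    simp only [jacPhi]
    refine (norm_sub_le _ _).trans ?_
    have h1 := (ContinuousLinearMap.opNorm_comp_le
      (1 - α • hessW f (innerIter f α m w φ) φ) (jacPhi f α m w φ)).trans
      (mul_le_mul (hstep _ _) ih (norm_nonneg _) h0)
    have h2 : ‖α • ContinuousLinearMap.adjoint (crossD f (innerIter f α m w φ) φ)‖ ≤ α * L := by
      rw [norm_smul, Real.norm_eq_abs, abs_of_nonneg hα, LinearIsometryEquiv.norm_map]
      exact mul_le_mul_of_nonneg_left (crossD_norm_le hL h _ _) hα
    have : (1 - α * μc) * (L / μc) + α * L = L / μc := by field_simp; ring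
    linarith

theorem iter_diff {p q : ℕ} {L μc α : ℝ} {f : Wsp p × Wsp q → ℝ} (hf : ContDiff ℝ 2 f)
    (h : GradLip L f) (hμ : 0 < μc) (hα : 0 ≤ α) (hL : 0 ≤ L)
    (hstep : ∀ w φ, ‖1 - α • hessW f w φ‖ ≤ 1 - α * μc)
    (w₁ w₂ : Wsp p) (φ₁ φ₂ : Wsp q) (m : ℕ) :
    ‖innerIter f α m w₁ φ₁ - innerIter f α m w₂ φ₂‖
      ≤ (1 - α * μc) ^ m * ‖w₁ - w₂‖ + L / μc * ‖φ₁ - φ₂‖ := by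
  induction m with
  | zero =>
    simp only [innerIter, pow_zero, one_mul]
    have : 0 ≤ L / μc * ‖φ₁ - φ₂‖ := by positivity
    linarith
  | succ m ih =>
    have h0 : 0 ≤ 1 - α * μc := (norm_nonneg _).trans (hstep w₁ φ₁)
    simp only [innerIter]
    set x := innerIter f α m w₁ φ₁
    set y := innerIter f α m w₂ φ₂
    have e : x - α • gradW f x φ₁ - (y - α • gradW f y φ₂)
        = ((x - α • gradW f x φ₁) - (y - α • gradW f y φ₁))
          - α • (gradW f y φ₁ - gradW f y φ₂) := by
      rw [smul_sub]; abel
    rw [e]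
    refine (norm_sub_le _ _).trans ?_
    have h1 := step_contract hf φ₁ (fun w => hstep w φ₁) x y
    have h2 : ‖α • (gradW f y φ₁ - gradW f y φ₂)‖ ≤ α * (L * ‖φ₁ - φ₂‖) := by
      rw [norm_smul, Real.norm_eq_abs, abs_of_nonneg hα]
      exact mul_le_mul_of_nonneg_left (gradLip_w2 h _ _ _) hα
    have h3 := mul_le_mul_of_nonneg_left ih h0
    have : (1 - α * μc) * ((1 - α * μc) ^ m * ‖w₁ - w₂‖ + L / μc * ‖φ₁ - φ₂‖)
        + α * (L * ‖φ₁ - φ₂‖)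
        = (1 - α * μc) ^ (m + 1) * ‖w₁ - w₂‖ + L / μc * ‖φ₁ - φ₂‖ := by
      rw [pow_succ]; field_simp; ring
    linarith

theorem jac_diff {p q : ℕ} {L μc α ρ τ : ℝ} {f : Wsp p × Wsp q → ℝ} (hf : ContDiff ℝ 2 f)
    (h : GradLip L f) (hH : HessLip ρ f) (hC : CrossLip τ f) (hρ : 0 ≤ ρ) (hτ : 0 ≤ τ)
    (hμ : 0 < μc) (hα : 0 ≤ α) (hL : 0 ≤ L) (hc : 0 < 1 - α * μc)
    (hstep : ∀ w φ, ‖1 - α • hessW f w φ‖ ≤ 1 - α * μc)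
    (w₁ w₂ : Wsp p) (φ₁ φ₂ : Wsp q) (m : ℕ) :
    ‖jacPhi f α m w₁ φ₁ - jacPhi f α m w₂ φ₂‖
      ≤ α * (τ + ρ * (L / μc)) * (m * (1 - α * μc) ^ m / (1 - α * μc)) * ‖w₁ - w₂‖
        + (τ + ρ * (L / μc)) / μc * (L / μc + 1) * ‖φ₁ - φ₂‖ := by
  induction m with
  | zero =>
    simp only [jacPhi, sub_self, norm_zero]
    have : 0 ≤ (τ + ρ * (L / μc)) / μc * (L / μc + 1) * ‖φ₁ - φ₂‖ := by positivity
    simpa using this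
  | succ m ih =>
    simp only [jacPhi]
    have hd := iter_diff hf h hμ hα hL hstep w₁ w₂ φ₁ φ₂ m
    set x := innerIter f α m w₁ φ₁
    set y := innerIter f α m w₂ φ₂
    have hJ := jac_norm_le hL h hμ hα hstep w₂ φ₂ m
    set J₁ := jacPhi f α m w₁ φ₁
    set J₂ := jacPhi f α m w₂ φ₂
    have hs := (aux_sqrt_add ‖x - y‖ ‖φ₁ - φ₂‖ (norm_nonneg _) (norm_nonneg _))
    have hsb : Real.sqrt (‖x - y‖ ^ 2 + ‖φ₁ - φ₂‖ ^ 2)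
        ≤ (1 - α * μc) ^ m * ‖w₁ - w₂‖ + (L / μc + 1) * ‖φ₁ - φ₂‖ := by linarith
    set B := (1 - α * μc) ^ m * ‖w₁ - w₂‖ + (L / μc + 1) * ‖φ₁ - φ₂‖ with hB
    have e : (1 - α • hessW f x φ₁).comp J₁ - α • ContinuousLinearMap.adjoint (crossD f x φ₁)
        - ((1 - α • hessW f y φ₂).comp J₂ - α • ContinuousLinearMap.adjoint (crossD f y φ₂))
        = (1 - α • hessW f x φ₁).comp (J₁ - J₂)
          - (α • ((hessW f x φ₁ - hessW f y φ₂).comp J₂)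
          + α • ContinuousLinearMap.adjoint (crossD f x φ₁ - crossD f y φ₂)) := by
      rw [map_sub]
      ext1 u
      simp [smul_sub]
      abel
    rw [e]
    refine (norm_sub_le _ _).trans ?_
    have h1 := (ContinuousLinearMap.opNorm_comp_le (1 - α • hessW f x φ₁) (J₁ - J₂)).trans
      (mul_le_mul (hstep _ _) ih (norm_nonneg _) hc.le)
    have h2 : ‖α • ((hessW f x φ₁ - hessW f y φ₂).comp J₂)‖ ≤ α * (ρ * B * (L / μc)) := by
      rw [norm_smul, Real.norm_eq_abs, abs_of_nonneg hα]
      refine mul_le_mul_of_nonneg_left ?_ hα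
      refine (ContinuousLinearMap.opNorm_comp_le _ _).trans ?_
      have h5 : ‖hessW f x φ₁ - hessW f y φ₂‖ ≤ ρ * B :=
        (hH x y φ₁ φ₂).trans (mul_le_mul_of_nonneg_left hsb hρ)
      exact mul_le_mul h5 hJ (norm_nonneg _) ((norm_nonneg _).trans h5)
    have h3 : ‖α • ContinuousLinearMap.adjoint (crossD f x φ₁ - crossD f y φ₂)‖
        ≤ α * (τ * B) := by
      rw [norm_smul, Real.norm_eq_abs, abs_of_nonneg hα, LinearIsometryEquiv.norm_map]
      exact mul_le_mul_of_nonneg_left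
        ((hC x y φ₁ φ₂).trans (mul_le_mul_of_nonneg_left hsb hτ)) hα
    have h4 := norm_add_le (α • ((hessW f x φ₁ - hessW f y φ₂).comp J₂))
      (α • ContinuousLinearMap.adjoint (crossD f x φ₁ - crossD f y φ₂))
    refine (add_le_add h1 (h4.trans (add_le_add h2 h3))).trans (le_of_eq ?_)
    have hK : α * (ρ * B * (L / μc)) + α * (τ * B) = α * (τ + ρ * (L / μc)) * B := by ring
    rw [hK, hB]
    generalize τ + ρ * (L / μc) = K
    generalize L / μc + 1 = R
    have e1 : ((m + 1 : ℕ) : ℝ) * (1 - α * μc) ^ (m + 1) / (1 - α * μc)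
        = (1 - α * μc) * (m * (1 - α * μc) ^ m / (1 - α * μc)) + (1 - α * μc) ^ m := by
      have hne := hc.ne'
      rw [pow_succ]
      push_cast
      field_simp
    rw [e1]
    have e2 : K / μc * R = (1 - α * μc) * (K / μc * R) + α * K * R := by
      field_simp
      ring
    linear_combination (-‖φ₁ - φ₂‖) * e2

theorem aux_series (s : ℝ) (h0 : 0 ≤ s) (h1 : s ≤ 1) (n : ℕ) :
    ((n : ℝ) + 1) * s ^ n * (1 - s ^ 2) ≤ 2 := by
  have h2 : ((n : ℝ) + 1) * s ^ n ≤ ∑ k ∈ Finset.range (n + 1), s ^ k := by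
    have := Finset.card_nsmul_le_sum (Finset.range (n + 1)) (fun k => s ^ k) (s ^ n)
      (fun k hk => pow_le_pow_of_le_one h0 h1 (by simp at hk; omega))
    simpa using this
  have h3 : (∑ k ∈ Finset.range (n + 1), s ^ k) * (1 - s) = 1 - s ^ (n + 1) :=
    geom_sum_mul_neg s (n + 1)
  have h4 : ((n : ℝ) + 1) * s ^ n * (1 - s) ≤ 1 := by
    have := mul_le_mul_of_nonneg_right h2 (sub_nonneg.mpr h1)
    have := pow_nonneg h0 (n + 1)
    linarith
  nlinarith [mul_le_mul_of_nonneg_right h4 (by linarith : 0 ≤ 1 + s)]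

/-- Proposition 2, part 2: smoothness of the task meta-gradient in `φ`
under a strongly-convex inner loop with `α = μ/L²`. -/
theorem anil_meta_grad_phi_smooth_sc (p q : ℕ) (LS LD : Wsp p × Wsp q → ℝ)
    (hLS : ContDiff ℝ 2 LS) (hLD : ContDiff ℝ 2 LD) (L M ρ τ μc α : ℝ)
    (hLipS : GradLip L LS) (hLipD : GradLip L LD) (hFunD : FunLip M LD)
    (hHess : HessLip ρ LS) (hCross : CrossLip τ LS) (hSC : StrongConvexIn μc LS)
    (hμ : 0 < μc) (hμL : μc < L) (hα : α = μc / L ^ 2) :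
    ∀ (N : ℕ), 1 ≤ N → ∀ (w₁ w₂ : Wsp p) (φ₁ φ₂ : Wsp q),
      ‖gradient (fun ψ => LD (innerIter LS α N w₁ ψ, ψ)) φ₁
          - gradient (fun ψ => LD (innerIter LS α N w₂ ψ, ψ)) φ₂‖
        ≤ (L + 2 * τ * M / μc + (2 * L * M / μc) * (α * ρ / (1 - α * μc) + 2 * ρ / μc)
              + L ^ 2 / μc) * (1 - α * μc) ^ (((N : ℝ) - 1) / 2) * ‖w₁ - w₂‖
          + (L + τ * M / μc + L * M * ρ / μc ^ 2 + L ^ 2 / μc) * (2 * L / μc + 1)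
              * ‖φ₁ - φ₂‖ := by
  intro N hN w₁ w₂ φ₁ φ₂
  obtain ⟨n, rfl⟩ : ∃ n, N = n + 1 := ⟨N - 1, by omega⟩
  by_cases hw : w₁ = w₂ ∧ φ₁ = φ₂
  · obtain ⟨rfl, rfl⟩ := hw
    simp
  have hpos : 0 < Real.sqrt (‖w₁ - w₂‖ ^ 2 + ‖φ₁ - φ₂‖ ^ 2) := by
    apply Real.sqrt_pos.mpr
    by_cases h1 : w₁ = w₂
    · have h2 : φ₁ ≠ φ₂ := fun h => hw ⟨h1, h⟩
      have := norm_pos_iff.mpr (sub_ne_zero.mpr h2)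
      positivity
    · have := norm_pos_iff.mpr (sub_ne_zero.mpr h1)
      positivity
  have hM : 0 ≤ M :=
    nonneg_of_mul_nonneg_left ((abs_nonneg _).trans (hFunD w₁ w₂ φ₁ φ₂)) hpos
  have hρ : 0 ≤ ρ :=
    nonneg_of_mul_nonneg_left ((norm_nonneg _).trans (hHess w₁ w₂ φ₁ φ₂)) hpos
  have hτ : 0 ≤ τ :=
    nonneg_of_mul_nonneg_left ((norm_nonneg _).trans (hCross w₁ w₂ φ₁ φ₂)) hpos
  have hLp : 0 < L := hμ.trans hμL
  have hL : 0 ≤ L := hLp.le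
  have hαp : 0 < α := by rw [hα]; positivity
  have hαL : α * L ≤ 1 := by
    rw [hα, div_mul_eq_mul_div, div_le_one (by positivity)]
    nlinarith
  have hc : 0 < 1 - α * μc := by nlinarith
  have hstep : ∀ w φ, ‖1 - α • hessW LS w φ‖ ≤ 1 - α * μc :=
    step_norm_le hLS hL hLipS hSC hαp.le hαL hc.le
  have hDd : Differentiable ℝ LD := hLD.differentiable (by norm_num)
  rw [gradient_comp hDd _ _ φ₁ (innerIter_hasFDerivAt hLS α w₁ φ₁ (n + 1)),
    gradient_comp hDd _ _ φ₂ (innerIter_hasFDerivAt hLS α w₂ φ₂ (n + 1))]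
  have hd := iter_diff hLS hLipS hμ hαp.le hL hstep w₁ w₂ φ₁ φ₂ (n + 1)
  have hJ := jac_norm_le hL hLipS hμ hαp.le hstep w₁ φ₁ (n + 1)
  have hJd := jac_diff hLS hLipS hHess hCross hρ hτ hμ hαp.le hL hc hstep w₁ w₂ φ₁ φ₂ (n + 1)
  set x := innerIter LS α (n + 1) w₁ φ₁
  set y := innerIter LS α (n + 1) w₂ φ₂
  set J₁ := jacPhi LS α (n + 1) w₁ φ₁
  set J₂ := jacPhi LS α (n + 1) w₂ φ₂
  have hs := (aux_sqrt_add ‖x - y‖ ‖φ₁ - φ₂‖ (norm_nonneg _) (norm_nonneg _))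
  have hsb : Real.sqrt (‖x - y‖ ^ 2 + ‖φ₁ - φ₂‖ ^ 2)
      ≤ (1 - α * μc) ^ (n + 1) * ‖w₁ - w₂‖ + (L / μc + 1) * ‖φ₁ - φ₂‖ := by linarith
  have e : gradPhi LD x φ₁ + ContinuousLinearMap.adjoint J₁ (gradW LD x φ₁)
      - (gradPhi LD y φ₂ + ContinuousLinearMap.adjoint J₂ (gradW LD y φ₂))
      = (gradPhi LD x φ₁ - gradPhi LD y φ₂)
        + (ContinuousLinearMap.adjoint J₁ (gradW LD x φ₁ - gradW LD y φ₂)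
          + ContinuousLinearMap.adjoint (J₁ - J₂) (gradW LD y φ₂)) := by
    simp only [map_sub, sub_apply]
    abel
  rw [e]
  refine (norm_add_le _ _).trans ((add_le_add_right (norm_add_le _ _) _).trans ?_)
  have t1 := (gradLip_phi hLipD x y φ₁ φ₂).trans (mul_le_mul_of_nonneg_left hsb hL)
  have t2 := (gradLip_w hLipD x y φ₁ φ₂).trans (mul_le_mul_of_nonneg_left hsb hL)
  have t3 : ‖ContinuousLinearMap.adjoint J₁ (gradW LD x φ₁ - gradW LD y φ₂)‖
      ≤ L / μc * (L * ((1 - α * μc) ^ (n + 1) * ‖w₁ - w₂‖ + (L / μc + 1) * ‖φ₁ - φ₂‖)) := by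
    refine (ContinuousLinearMap.le_opNorm _ _).trans ?_
    rw [LinearIsometryEquiv.norm_map]
    exact mul_le_mul hJ t2 (norm_nonneg _) (by positivity)
  have t4 : ‖ContinuousLinearMap.adjoint (J₁ - J₂) (gradW LD y φ₂)‖
      ≤ (α * (τ + ρ * (L / μc)) * (((n + 1 : ℕ) : ℝ) * (1 - α * μc) ^ (n + 1) / (1 - α * μc))
          * ‖w₁ - w₂‖ + (τ + ρ * (L / μc)) / μc * (L / μc + 1) * ‖φ₁ - φ₂‖) * M := by
    refine (ContinuousLinearMap.le_opNorm _ _).trans ?_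
    rw [LinearIsometryEquiv.norm_map]
    exact mul_le_mul hJd (gradW_norm_le hM hFunD _ _) (norm_nonneg _) ((norm_nonneg _).trans hJd)
  refine (add_le_add t1 (add_le_add t3 t4)).trans ?_
  clear t1 t2 t3 t4 e hsb hs hJd hJ hd hDd hstep hpos
  -- scalar part
  have hexp : (1 - α * μc) ^ ((((n + 1 : ℕ) : ℝ) - 1) / 2) = Real.sqrt (1 - α * μc) ^ n := by
    rw [Real.sqrt_eq_rpow, ← Real.rpow_natCast, ← Real.rpow_mul hc.le]
    congr 1
    push_cast
    ring
  rw [hexp]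
  set s := Real.sqrt (1 - α * μc) with hsdef
  have hs0 : 0 ≤ s := Real.sqrt_nonneg _
  have hsq : s ^ 2 = 1 - α * μc := Real.sq_sqrt hc.le
  have hs1 : s ≤ 1 := Real.sqrt_le_one.mpr (by nlinarith [mul_pos hαp hμ])
  have hser := aux_series s hs0 hs1 n
  have hsn : 0 ≤ s ^ n := pow_nonneg hs0 n
  have hsn1 : s ^ n ≤ 1 := pow_le_one₀ hs0 hs1
  have hcn : (1 - α * μc) ^ n = s ^ n * s ^ n := by rw [← hsq]; ring
  have hb1 : (1 - α * μc) ^ (n + 1) ≤ s ^ n := by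
    rw [pow_succ, hcn]
    have : s ^ n * s ^ n ≤ s ^ n := by nlinarith
    nlinarith [mul_pos hαp hμ, mul_nonneg hsn hsn]
  have hb2 : α * (((n + 1 : ℕ) : ℝ) * (1 - α * μc) ^ (n + 1) / (1 - α * μc))
      ≤ 2 / μc * s ^ n := by
    have e1 : ((n + 1 : ℕ) : ℝ) * (1 - α * μc) ^ (n + 1) / (1 - α * μc)
        = ((n : ℝ) + 1) * (s ^ n * s ^ n) := by
      rw [← hcn, pow_succ]
      have hne := hc.ne'
      push_cast
      field_simp
    rw [e1, div_mul_eq_mul_div, le_div_iff₀ hμ]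
    have e2 : 1 - s ^ 2 = α * μc := by rw [hsq]; ring
    rw [e2] at hser
    nlinarith [mul_le_mul_of_nonneg_right hser hsn]
  have hK : 0 ≤ τ + ρ * (L / μc) := by positivity
  set P := ((n + 1 : ℕ) : ℝ) * (1 - α * μc) ^ (n + 1) / (1 - α * μc)
  have hA : L * (1 - α * μc) ^ (n + 1) + L / μc * (L * (1 - α * μc) ^ (n + 1))
      + α * (τ + ρ * (L / μc)) * P * M
      ≤ (L + 2 * τ * M / μc + (2 * L * M / μc) * (α * ρ / (1 - α * μc) + 2 * ρ / μc)
              + L ^ 2 / μc) * s ^ n := by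
    have g1 := mul_le_mul_of_nonneg_left hb1 (by positivity : 0 ≤ L + L ^ 2 / μc)
    have g2 := mul_le_mul_of_nonneg_left hb2 (mul_nonneg hK hM)
    have g3 : 0 ≤ ((2 * L * M / μc) * (α * ρ / (1 - α * μc)) + 2 * L * M * ρ / μc ^ 2) * s ^ n := by
      positivity
    have g4 : (L + L ^ 2 / μc) * s ^ n + (τ + ρ * (L / μc)) * M * (2 / μc * s ^ n)
        + ((2 * L * M / μc) * (α * ρ / (1 - α * μc)) + 2 * L * M * ρ / μc ^ 2) * s ^ n
        = (L + 2 * τ * M / μc + (2 * L * M / μc) * (α * ρ / (1 - α * μc) + 2 * ρ / μc)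
              + L ^ 2 / μc) * s ^ n := by
      ring
    have g5 : L / μc * (L * (1 - α * μc) ^ (n + 1)) = L ^ 2 / μc * (1 - α * μc) ^ (n + 1) := by
      ring
    rw [g5]
    linarith
  have hBb : (L + L ^ 2 / μc + (τ + ρ * (L / μc)) / μc * M) * (L / μc + 1)
      ≤ (L + τ * M / μc + L * M * ρ / μc ^ 2 + L ^ 2 / μc) * (2 * L / μc + 1) := by
    have e1 : L + L ^ 2 / μc + (τ + ρ * (L / μc)) / μc * M
        = L + τ * M / μc + L * M * ρ / μc ^ 2 + L ^ 2 / μc := by ring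
    rw [e1]
    refine mul_le_mul_of_nonneg_left ?_ (by positivity)
    have : 0 ≤ L / μc := by positivity
    have : 2 * L / μc = L / μc + L / μc := by ring
    linarith
  have f1 := mul_le_mul_of_nonneg_right hA (norm_nonneg (w₁ - w₂))
  have f2 := mul_le_mul_of_nonneg_right hBb (norm_nonneg (φ₁ - φ₂))
  refine le_trans (le_of_eq ?_) (add_le_add f1 f2)
  ring
end
end

section
/- Suppose (A1) the gradients of L_S and L_D are L-Lipschitz on W × Φ with L > 0, (A2) L_D is M-Lipschitz, (A3) (w,φ) ↦ ∇²_w L_S(w,φ) is ρ-Lipschitz in operator norm, and α > 0. Then for every N ≥ 1 and all (w₁,φ₁), (w₂,φ₂) ∈ W × Φ: ‖G_w(w₁,φ₁) − G_w(w₂,φ₂)‖ ≤ (L(1 + αL) + 2Mρ/L)(1 + αL)^{2N−1} (‖w₁ − w₂‖ + ‖φ₁ − φ₂‖). -/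
noncomputable section

open scoped RealInnerProductSpace

theorem aux_sqrt_le {a b : ℝ} (ha : 0 ≤ a) (hb : 0 ≤ b) : Real.sqrt (a ^ 2 + b ^ 2) ≤ a + b := by
  rw [Real.sqrt_le_left (by positivity)]
  nlinarith [mul_nonneg ha hb]

theorem aux_gradLip {p q : ℕ} {L : ℝ} {f : Wsp p × Wsp q → ℝ} (h : GradLip L f) (hL : 0 < L)
    (w₁ w₂ : Wsp p) (φ₁ φ₂ : Wsp q) :
    ‖gradW f w₁ φ₁ - gradW f w₂ φ₂‖ ≤ L * (‖w₁ - w₂‖ + ‖φ₁ - φ₂‖) := by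
  calc ‖gradW f w₁ φ₁ - gradW f w₂ φ₂‖
      ≤ Real.sqrt (‖gradW f w₁ φ₁ - gradW f w₂ φ₂‖ ^ 2
          + ‖gradPhi f w₁ φ₁ - gradPhi f w₂ φ₂‖ ^ 2) := by
        apply Real.le_sqrt_of_sq_le
        nlinarith [sq_nonneg ‖gradPhi f w₁ φ₁ - gradPhi f w₂ φ₂‖]
    _ ≤ _ := h w₁ w₂ φ₁ φ₂
    _ ≤ _ := by
        have := aux_sqrt_le (norm_nonneg (w₁ - w₂)) (norm_nonneg (φ₁ - φ₂))
        gcongr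

theorem aux_slice {p q : ℕ} {f : Wsp p × Wsp q → ℝ} (hf : ContDiff ℝ 2 f) (φ : Wsp q) :
    ContDiff ℝ 2 (fun u => f (u, φ)) :=
  hf.comp (contDiff_id.prodMk contDiff_const)

theorem aux_gradW_diff {p q : ℕ} {f : Wsp p × Wsp q → ℝ} (hf : ContDiff ℝ 2 f) (φ : Wsp q) :
    Differentiable ℝ (fun u => gradW f u φ) := by
  have h1 : ContDiff ℝ 1 (fderiv ℝ (fun u => f (u, φ))) :=
    (aux_slice hf φ).fderiv_right (by norm_num)
  have h2 : Differentiable ℝ (fderiv ℝ (fun u => f (u, φ))) := h1.differentiable (by norm_num)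
  exact ((InnerProductSpace.toDual ℝ (Wsp p)).symm.toContinuousLinearEquiv.differentiable).comp h2

theorem aux_hess_norm {p q : ℕ} {L : ℝ} {f : Wsp p × Wsp q → ℝ} (h : GradLip L f) (hL : 0 < L)
    (w : Wsp p) (φ : Wsp q) : ‖hessW f w φ‖ ≤ L := by
  have : LipschitzWith ⟨L, hL.le⟩ (fun u => gradW f u φ) := by
    apply LipschitzWith.of_dist_le_mul
    intro x y
    have := aux_gradLip h hL x y φ φ
    simp only [sub_self, norm_zero, add_zero, ne_eq, OfNat.ofNat_ne_zero, not_false_eq_true,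
      zero_pow, norm_nonneg, Real.sqrt_sq] at this
    rw [dist_eq_norm, dist_eq_norm]
    exact this
  exact norm_fderiv_le_of_lipschitz ℝ this

theorem aux_grad_norm {p q : ℕ} {M : ℝ} {f : Wsp p × Wsp q → ℝ} (h : FunLip M f) (hM : 0 ≤ M)
    (w : Wsp p) (φ : Wsp q) : ‖gradW f w φ‖ ≤ M := by
  have : LipschitzWith ⟨M, hM⟩ (fun u => f (u, φ)) := by
    apply LipschitzWith.of_dist_le_mul
    intro x y
    have := h x y φ φ
    simp only [sub_self, norm_zero, add_zero, ne_eq, OfNat.ofNat_ne_zero, not_false_eq_true,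
      zero_pow, norm_nonneg, Real.sqrt_sq] at this
    rw [dist_eq_norm, dist_eq_norm]
    exact this
  have h2 := norm_fderiv_le_of_lipschitz ℝ this (x₀ := w)
  unfold gradW gradient
  rw [LinearIsometryEquiv.norm_map]
  exact h2

/-- Jacobian of the inner iterates. -/
def jacIter {p q : ℕ} (f : Wsp p × Wsp q → ℝ) (α : ℝ) (w : Wsp p) (φ : Wsp q) :
    ℕ → (Wsp p →L[ℝ] Wsp p)
  | 0 => ContinuousLinearMap.id ℝ _
  | (m+1) => jacIter f α w φ m - α • (hessW f (innerIter f α m w φ) φ).comp (jacIter f α w φ m)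

theorem aux_jac {p q : ℕ} {f : Wsp p × Wsp q → ℝ} (hf : ContDiff ℝ 2 f) (α : ℝ)
    (w : Wsp p) (φ : Wsp q) (m : ℕ) :
    HasFDerivAt (fun u => innerIter f α m u φ) (jacIter f α w φ m) w := by
  induction m with
  | zero => exact hasFDerivAt_id w
  | succ m ih =>
    have h1 : HasFDerivAt (fun u => gradW f u φ) (hessW f (innerIter f α m w φ) φ)
        (innerIter f α m w φ) := (aux_gradW_diff hf φ _).hasFDerivAt
    exact ih.sub ((h1.comp w ih).const_smul α)

theorem aux_meta {p q : ℕ} {f g : Wsp p × Wsp q → ℝ} (hf : ContDiff ℝ 2 f) (hg : ContDiff ℝ 2 g)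
    (α : ℝ) (w : Wsp p) (φ : Wsp q) (m : ℕ) :
    gradient (fun u => g (innerIter f α m u φ, φ)) w
      = ContinuousLinearMap.adjoint (jacIter f α w φ m) (gradW g (innerIter f α m w φ) φ) := by
  have h1 : HasFDerivAt (fun u => g (u, φ)) (fderiv ℝ (fun u => g (u, φ)) (innerIter f α m w φ))
      (innerIter f α m w φ) :=
    (((aux_slice hg φ).differentiable (by norm_num)) _).hasFDerivAt
  have h2 := (h1.comp w (aux_jac hf α w φ m)).fderiv
  apply ext_inner_right ℝ
  intro v
  rw [ContinuousLinearMap.adjoint_inner_left]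
  unfold gradW gradient
  rw [InnerProductSpace.toDual_symm_apply, InnerProductSpace.toDual_symm_apply]
  change (fderiv ℝ ((fun u => g (u, φ)) ∘ fun u => innerIter f α m u φ) w) v = _
  rw [h2]
  rfl

theorem aux_iter {p q : ℕ} {f : Wsp p × Wsp q → ℝ} {L α : ℝ} (h : GradLip L f) (hL : 0 < L)
    (hα : 0 < α) (w₁ w₂ : Wsp p) (φ₁ φ₂ : Wsp q) (m : ℕ) :
    ‖innerIter f α m w₁ φ₁ - innerIter f α m w₂ φ₂‖ + ‖φ₁ - φ₂‖
      ≤ (1 + α * L) ^ m * (‖w₁ - w₂‖ + ‖φ₁ - φ₂‖) := by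
  induction m with
  | zero => simp [innerIter]
  | succ m ih =>
    simp only [innerIter]
    set a := innerIter f α m w₁ φ₁
    set b := innerIter f α m w₂ φ₂
    have h1 := aux_gradLip h hL a b φ₁ φ₂
    have h2 : ‖a - α • gradW f a φ₁ - (b - α • gradW f b φ₂)‖
        ≤ ‖a - b‖ + α * ‖gradW f a φ₁ - gradW f b φ₂‖ := by
      have : a - α • gradW f a φ₁ - (b - α • gradW f b φ₂)
          = (a - b) - α • (gradW f a φ₁ - gradW f b φ₂) := by module
      rw [this]
      refine (norm_sub_le _ _).trans ?_
      rw [norm_smul, Real.norm_of_nonneg hα.le]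
    have h3 := mul_le_mul_of_nonneg_left h1 hα.le
    have h4 := mul_le_mul_of_nonneg_left ih (show 0 ≤ 1 + α * L by positivity)
    rw [pow_succ]
    linarith

theorem aux_jac_norm {p q : ℕ} {f : Wsp p × Wsp q → ℝ} {L α : ℝ} (h : GradLip L f) (hL : 0 < L)
    (hα : 0 < α) (w : Wsp p) (φ : Wsp q) (m : ℕ) :
    ‖jacIter f α w φ m‖ ≤ (1 + α * L) ^ m := by
  induction m with
  | zero => simpa [jacIter] using ContinuousLinearMap.norm_id_le
  | succ m ih =>
    simp only [jacIter]
    set J := jacIter f α w φ m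
    have h1 := aux_hess_norm h hL (innerIter f α m w φ) φ
    set H := hessW f (innerIter f α m w φ) φ
    calc ‖J - α • H.comp J‖ ≤ ‖J‖ + α * (‖H‖ * ‖J‖) := by
          refine (norm_sub_le _ _).trans ?_
          rw [norm_smul, Real.norm_of_nonneg hα.le]
          gcongr
          exact ContinuousLinearMap.opNorm_comp_le _ _
      _ ≤ ‖J‖ + α * (L * ‖J‖) := by gcongr
      _ = (1 + α * L) * ‖J‖ := by ring
      _ ≤ (1 + α * L) * (1 + α * L) ^ m := by gcongr
      _ = _ := by ring

theorem aux_jac_diff {p q : ℕ} {f : Wsp p × Wsp q → ℝ} {L α ρ : ℝ} (h : GradLip L f) (hL : 0 < L)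
    (hα : 0 < α) (hH : HessLip ρ f) (hρ : 0 ≤ ρ) (w₁ w₂ : Wsp p) (φ₁ φ₂ : Wsp q) (m : ℕ) :
    (1 + α * L) * L * ‖jacIter f α w₁ φ₁ m - jacIter f α w₂ φ₂ m‖
      ≤ ρ * (‖w₁ - w₂‖ + ‖φ₁ - φ₂‖) * (1 + α * L) ^ m * ((1 + α * L) ^ m - 1) := by
  induction m with
  | zero => simp [jacIter]
  | succ m ih =>
    simp only [jacIter]
    have hn := aux_hess_norm h hL (innerIter f α m w₁ φ₁) φ₁
    have hd := hH (innerIter f α m w₁ φ₁) (innerIter f α m w₂ φ₂) φ₁ φ₂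
    have hit := aux_iter h hL hα w₁ w₂ φ₁ φ₂ m
    have hs := aux_sqrt_le (norm_nonneg (innerIter f α m w₁ φ₁ - innerIter f α m w₂ φ₂))
      (norm_nonneg (φ₁ - φ₂))
    have hd2 := hd.trans (mul_le_mul_of_nonneg_left (hs.trans hit) hρ)
    have hJ := aux_jac_norm h hL hα w₂ φ₂ m
    set J := jacIter f α w₁ φ₁ m
    set K := jacIter f α w₂ φ₂ m
    set H := hessW f (innerIter f α m w₁ φ₁) φ₁
    set Hb := hessW f (innerIter f α m w₂ φ₂) φ₂
    set s := ‖w₁ - w₂‖ + ‖φ₁ - φ₂‖ with hsdef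
    have hs0 : 0 ≤ s := by positivity
    have hc : 0 < 1 + α * L := by positivity
    set c := 1 + α * L with hcdef
    have key : ‖J - α • H.comp J - (K - α • Hb.comp K)‖
        ≤ c * ‖J - K‖ + α * (ρ * (c ^ m * s) * c ^ m) := by
      have e : J - α • H.comp J - (K - α • Hb.comp K)
          = (J - K) - α • (H.comp (J - K) + (H - Hb).comp K) := by
        ext1 x
        simp
        module
      rw [e]
      calc _ ≤ ‖J - K‖ + α * (‖H‖ * ‖J - K‖ + ‖H - Hb‖ * ‖K‖) := by
            refine (norm_sub_le _ _).trans ?_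
            rw [norm_smul, Real.norm_of_nonneg hα.le]
            gcongr
            refine (norm_add_le _ _).trans ?_
            gcongr <;> exact ContinuousLinearMap.opNorm_comp_le _ _
        _ ≤ ‖J - K‖ + α * (L * ‖J - K‖ + (ρ * (c ^ m * s)) * c ^ m) := by
            gcongr
        _ = _ := by rw [hcdef]; ring
    calc _ ≤ c * L * (c * ‖J - K‖ + α * (ρ * (c ^ m * s) * c ^ m)) := by gcongr
      _ = c * (c * L * ‖J - K‖) + c * (α * L) * (ρ * (c ^ m * s) * c ^ m) := by ring
      _ ≤ c * (ρ * s * c ^ m * (c ^ m - 1)) + c * (α * L) * (ρ * (c ^ m * s) * c ^ m) := by gcongr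
      _ = _ := by
        have : α * L = c - 1 := by rw [hcdef]; ring
        rw [this]; ring

/-- Proposition 3, part 1: smoothness of the task meta-gradient in `w`
in the nonconvex case. -/
theorem anil_meta_grad_w_smooth_nonconvex (p q : ℕ) (LS LD : Wsp p × Wsp q → ℝ)
    (hLS : ContDiff ℝ 2 LS) (hLD : ContDiff ℝ 2 LD) (L M ρ α : ℝ)
    (hLipS : GradLip L LS) (hLipD : GradLip L LD) (hL : 0 < L)
    (hFunD : FunLip M LD) (hHess : HessLip ρ LS) (hα : 0 < α) :
    ∀ (N : ℕ), 1 ≤ N → ∀ (w₁ w₂ : Wsp p) (φ₁ φ₂ : Wsp q),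
      ‖gradient (fun u => LD (innerIter LS α N u φ₁, φ₁)) w₁
          - gradient (fun u => LD (innerIter LS α N u φ₂, φ₂)) w₂‖
        ≤ (L * (1 + α * L) + 2 * M * ρ / L) * (1 + α * L) ^ (2 * N - 1)
            * (‖w₁ - w₂‖ + ‖φ₁ - φ₂‖) := by
  intro N hN w₁ w₂ φ₁ φ₂
  rcases eq_or_lt_of_le (show 0 ≤ ‖w₁ - w₂‖ + ‖φ₁ - φ₂‖ by positivity) with h0 | hpos
  · have hw : ‖w₁ - w₂‖ = 0 := by linarith [norm_nonneg (w₁ - w₂), norm_nonneg (φ₁ - φ₂)]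
    have hp : ‖φ₁ - φ₂‖ = 0 := by linarith [norm_nonneg (w₁ - w₂), norm_nonneg (φ₁ - φ₂)]
    rw [norm_sub_eq_zero_iff] at hw hp
    subst hw hp
    simp
  have hsq : 0 < Real.sqrt (‖w₁ - w₂‖ ^ 2 + ‖φ₁ - φ₂‖ ^ 2) := by
    apply Real.sqrt_pos.mpr
    by_contra hcon
    have h1 := sq_nonneg ‖w₁ - w₂‖
    have h2 := sq_nonneg ‖φ₁ - φ₂‖
    have hw : ‖w₁ - w₂‖ = 0 := pow_eq_zero_iff (two_ne_zero) |>.mp (by linarith)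
    have hp : ‖φ₁ - φ₂‖ = 0 := pow_eq_zero_iff (two_ne_zero) |>.mp (by linarith)
    linarith
  have hM : 0 ≤ M := nonneg_of_mul_nonneg_left ((abs_nonneg _).trans (hFunD w₁ w₂ φ₁ φ₂)) hsq
  have hρ : 0 ≤ ρ := nonneg_of_mul_nonneg_left ((norm_nonneg _).trans (hHess w₁ w₂ φ₁ φ₂)) hsq
  rw [aux_meta hLS hLD, aux_meta hLS hLD]
  have hJd := aux_jac_diff hLipS hL hα hHess hρ w₁ w₂ φ₁ φ₂ N
  have hJ := aux_jac_norm hLipS hL hα w₁ φ₁ N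
  have hit := aux_iter hLipS hL hα w₁ w₂ φ₁ φ₂ N
  have hg := (aux_gradLip hLipD hL (innerIter LS α N w₁ φ₁) (innerIter LS α N w₂ φ₂) φ₁ φ₂).trans
    (mul_le_mul_of_nonneg_left hit hL.le)
  have hgn := aux_grad_norm hFunD hM (innerIter LS α N w₂ φ₂) φ₂
  set J := jacIter LS α w₁ φ₁ N
  set K := jacIter LS α w₂ φ₂ N
  set a := gradW LD (innerIter LS α N w₁ φ₁) φ₁
  set b := gradW LD (innerIter LS α N w₂ φ₂) φ₂
  set s := ‖w₁ - w₂‖ + ‖φ₁ - φ₂‖ with hsdef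
  have hc : 0 < 1 + α * L := by positivity
  set c := 1 + α * L with hcdef
  obtain ⟨n, rfl⟩ : ∃ n, N = n + 1 := ⟨N - 1, by omega⟩
  have hJK : ‖J - K‖ ≤ ρ / L * c ^ (2 * n + 1) * s := by
    have h1 : c * L * ‖J - K‖ ≤ c * L * (ρ / L * c ^ (2 * n + 1) * s) := by
      have e : c * L * (ρ / L * c ^ (2 * n + 1) * s) = ρ * s * c ^ (n + 1) * c ^ (n + 1) := by
        field_simp
        ring
      rw [e]
      refine hJd.trans ?_
      gcongr
      linarith
    exact le_of_mul_le_mul_left h1 (by positivity)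
  have e : ContinuousLinearMap.adjoint J a - ContinuousLinearMap.adjoint K b
      = ContinuousLinearMap.adjoint J (a - b) + ContinuousLinearMap.adjoint (J - K) b := by
    simp
  have e2 : 2 * (n + 1) - 1 = 2 * n + 1 := by omega
  rw [e, e2]
  calc _ ≤ ‖J‖ * ‖a - b‖ + ‖J - K‖ * ‖b‖ := by
        refine (norm_add_le _ _).trans ?_
        gcongr
        · refine (ContinuousLinearMap.le_opNorm _ _).trans ?_
          rw [LinearIsometryEquiv.norm_map]
        · refine (ContinuousLinearMap.le_opNorm _ _).trans ?_
          rw [LinearIsometryEquiv.norm_map]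
    _ ≤ c ^ (n + 1) * (L * (c ^ (n + 1) * s)) + ρ / L * c ^ (2 * n + 1) * s * M := by
        gcongr
    _ = (L * c + M * ρ / L) * c ^ (2 * n + 1) * s := by ring
    _ ≤ (L * c + 2 * M * ρ / L) * c ^ (2 * n + 1) * s := by
        gcongr
        nlinarith
end
end
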